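/- Let x ∈ R^{d−1} with dual Diophantine type strictly less than d, and define φ(q) = (q·(log q)²)^{−1/d}. Then the sum of φ(q) over all q ≥ 2 satisfying ‖qx‖ < φ(q) converges. -/

import Mathlib

open scoped Classical ENNReal

/-- Sup-norm distance from `x ∈ ℝ^ℓ` to the nearest integer point of `ℤ^ℓ`. -/
noncomputable def distInt {l : ℕ} (x : Fin l → ℝ) : ℝ :=
  ⨅ p : Fin l → ℤ, ‖x - fun i => (p i : ℝ)‖

/-- Distance from `t ∈ ℝ` to the nearest integer. -/
noncomputable def distZ (t : ℝ) : ℝ := ⨅ p : ℤ, |t - (p : ℝ)|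

/-- The dual Diophantine type of `x ∈ ℝ^ℓ`, valued in `ℝ≥0∞`. -/
noncomputable def tauD {l : ℕ} (x : Fin l → ℝ) : ℝ≥0∞ :=
  ⨆ τ ∈ {τ : ℝ | 0 < τ ∧
    {n : Fin l → ℤ | n ≠ 0 ∧
      distZ (∑ i, (n i : ℝ) * x i) < ‖fun i => ((n i : ℝ))‖ ^ (-τ)}.Infinite},
    ENNReal.ofReal τ

open MeasureTheory in
lemma re_fourier_ge (q : ℕ) (t : UnitAddCircle) (h : ‖q • t‖ ≤ 1/6) :
    1/2 ≤ (fourier (q:ℤ) t : ℂ).re := by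
  have key : ∀ u : UnitAddCircle, ‖u‖ ≤ 1/6 → 1/2 ≤ (AddCircle.toCircle u : ℂ).re := by
    intro u hu
    induction u using QuotientAddGroup.induction_on with
    | H y =>
      change ‖((y:ℝ):UnitAddCircle)‖ ≤ 1/6 at hu
      change 1/2 ≤ (AddCircle.toCircle ((y:ℝ):UnitAddCircle) : ℂ).re
      rw [UnitAddCircle.norm_eq] at hu
      have e : (AddCircle.toCircle ((y:ℝ):UnitAddCircle) : ℂ).re = Real.cos (2*Real.pi*y) := by
        rw [AddCircle.toCircle_apply_mk, Circle.coe_exp, Complex.exp_ofReal_mul_I_re]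
        simp
      have e2 : Real.cos (2*Real.pi*y) = Real.cos |2*Real.pi*(y - round y)| := by
        rw [Real.cos_abs, show 2*Real.pi*(y - round y) = 2*Real.pi*y - (round y : ℤ) * (2*Real.pi) by ring,
          Real.cos_sub_int_mul_two_pi]
      rw [e, e2, ← Real.cos_pi_div_three]
      have hp := Real.pi_pos
      apply Real.cos_le_cos_of_nonneg_of_le_pi (abs_nonneg _) (by linarith)
      rw [abs_mul, abs_of_pos (by positivity)]
      nlinarith
  rw [fourier_apply]
  apply key
  simpa using h

open MeasureTheory in
lemma bessel_aux (U : Set UnitAddCircle) (hU : MeasurableSet U) (S : Finset ℕ)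
    (h : ∀ q ∈ S, ∀ t ∈ U, ‖q • t‖ ≤ 1/6) (hpos : 0 < volume.real U) :
    (S.card : ℝ) * volume.real U ≤ 4 := by
  have hv : (volume : Measure UnitAddCircle) = AddCircle.haarAddCircle := by
    rw [AddCircle.volume_eq_smul_haarAddCircle]; simp
  rw [hv] at hpos ⊢
  set μ : Measure UnitAddCircle := AddCircle.haarAddCircle with hμ
  have hfin : μ U ≠ ⊤ := measure_ne_top _ _
  have B := Orthonormal.sum_inner_products_le (𝕜 := ℂ) (indicatorConstLp 2 hU hfin (1:ℂ))
    (s := S.map Nat.castEmbedding) (orthonormal_fourier (T := 1))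
  rw [norm_indicatorConstLp (by simp) (by simp)] at B
  have e : (‖(1:ℂ)‖ * μ.real U ^ (1 / (2:ENNReal).toReal))^2 = μ.real U := by
    simp [← Real.sqrt_eq_rpow, Real.sq_sqrt hpos.le]
    rw [← Real.rpow_natCast, ← Real.rpow_mul hpos.le]; norm_num
  rw [e, Finset.sum_map] at B
  have L : ∀ q ∈ S, (μ.real U)^2/4 ≤
      ‖inner ℂ (fourierLp (T := 1) 2 (Nat.castEmbedding q : ℤ)) (indicatorConstLp 2 hU hfin (1:ℂ))‖^2 := by
    intro q hq
    rw [norm_inner_symm, L2.inner_indicatorConstLp_one]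
    have e3 : ∫ x in U, (fourierLp (T := 1) 2 (Nat.castEmbedding q : ℤ)) x ∂μ
        = ∫ x in U, fourier (q:ℤ) x ∂μ := by
      apply integral_congr_ae
      exact ae_restrict_of_ae (coeFn_fourierLp 2 (q:ℤ))
    rw [e3]
    have hint : Integrable (fun x : UnitAddCircle => (fourier (q:ℤ) x : ℂ)) (μ.restrict U) := by
      apply Integrable.of_bound (C := 1)
      · exact (fourier (q:ℤ)).continuous.aestronglyMeasurable
      · filter_upwards with x
        rw [fourier_apply, Circle.norm_coe]
    have h1 : μ.real U / 2 ≤ ∫ x in U, (fourier (q:ℤ) x : ℂ).re ∂μ := by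
      have : ∫ x in U, (1/2:ℝ) ∂μ = μ.real U / 2 := by
        rw [setIntegral_const]; simp; ring
      rw [← this]
      apply setIntegral_mono_on _ hint.re hU
      · intro t ht
        exact re_fourier_ge q t (h q hq t ht)
      · exact integrable_const _
    have h2 : ∫ x in U, (fourier (q:ℤ) x : ℂ).re ∂μ = (∫ x in U, (fourier (q:ℤ) x : ℂ) ∂μ).re :=
      integral_re hint
    have h3 := Complex.re_le_norm (∫ x in U, (fourier (q:ℤ) x : ℂ) ∂μ)
    have : μ.real U / 2 ≤ ‖∫ x in U, (fourier (q:ℤ) x : ℂ) ∂μ‖ := by linarith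
    calc (μ.real U)^2/4 = (μ.real U/2)^2 := by ring
      _ ≤ _ := by gcongr
  have := (Finset.card_nsmul_le_sum S _ _ L).trans B
  rw [nsmul_eq_mul] at this
  have h5 : (S.card * μ.real U) * μ.real U ≤ 4 * μ.real U := by nlinarith
  exact le_of_mul_le_mul_right h5 hpos

lemma distZ_eq (t : ℝ) : distZ t = ‖(t : UnitAddCircle)‖ := by
  rw [UnitAddCircle.norm_eq]
  apply le_antisymm
  · exact ciInf_le ⟨0, by rintro _ ⟨p, rfl⟩; positivity⟩ (round t)
  · exact le_ciInf fun p => round_le t p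

lemma norm_le_of_distInt {l : ℕ} {y : Fin l → ℝ} {ε : ℝ} (h : distInt y < ε) (i : Fin l) :
    ‖(y i : UnitAddCircle)‖ ≤ ε := by
  obtain ⟨p, hp⟩ := exists_lt_of_ciInf_lt h
  rw [UnitAddCircle.norm_eq]
  refine (round_le _ (p i)).trans ?_
  have := norm_le_pi_norm (y - fun i => (p i : ℝ)) i
  simp only [Pi.sub_apply, Real.norm_eq_abs] at this
  linarith

open MeasureTheory in
lemma count_aux {l : ℕ} (x : Fin l → ℝ) (c τ : ℝ) (hc : 0 < c) (hτ : 0 < τ)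
    (hx : ∀ n : Fin l → ℤ, n ≠ 0 →
      c * ‖fun i => ((n i : ℝ))‖ ^ (-τ) ≤ distZ (∑ i, (n i : ℝ) * x i))
    (N : ℕ) (hN : 1 ≤ N) (Q ε r : ℝ) (hr : 0 < r) (hr2 : 2 * r ≤ 1) (hε : 0 ≤ ε)
    (hrc : 2 * r < c * (N:ℝ) ^ (-τ)) (hs : l * (N * ε) + Q * r ≤ 1/6)
    (S : Finset ℕ) (hS : ∀ q ∈ S, (q:ℝ) ≤ Q ∧ distInt (fun i => (q : ℝ) * x i) < ε) :
    (S.card : ℝ) * (N ^ l * (2 * r)) ≤ 4 := by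
  let θ : (Fin l → Fin N) → UnitAddCircle := fun n => ((∑ i, (n i : ℝ) * x i : ℝ) : UnitAddCircle)
  have hdisj : ((Finset.univ : Finset (Fin l → Fin N)) : Set (Fin l → Fin N)).PairwiseDisjoint
      (fun n => Metric.closedBall (θ n) r) := by
    intro n _ m _ hnm
    apply Metric.closedBall_disjoint_closedBall
    let k : Fin l → ℤ := fun i => (n i : ℤ) - (m i : ℤ)
    have hk : k ≠ 0 := by
      intro hk
      apply hnm
      ext i
      have := congrFun hk i
      simp only [k, Pi.zero_apply] at this
      omega
    have h1 := hx k hk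
    have e : ((∑ i, (k i : ℝ) * x i : ℝ) : UnitAddCircle) = θ n - θ m := by
      simp only [θ]
      rw [← AddCircle.coe_sub, ← Finset.sum_sub_distrib]
      congr 1
      apply Finset.sum_congr rfl
      intro i _
      simp only [k]; push_cast; ring
    rw [distZ_eq, e, ← dist_eq_norm] at h1
    have hkpos : 0 < ‖fun i => ((k i : ℝ))‖ := by
      rw [norm_pos_iff]
      intro h0; apply hk; ext i
      have := congrFun h0 i
      simpa using this
    have hkN : ‖fun i => ((k i : ℝ))‖ ≤ N := by
      rw [pi_norm_le_iff_of_nonneg (by positivity)]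
      intro i
      rw [Real.norm_eq_abs]
      have a1 := (n i).2
      have a2 := (m i).2
      have : |k i| ≤ (N:ℤ) := by
        simp only [k]; rw [abs_le]; constructor <;> omega
      exact_mod_cast this
    have := Real.rpow_le_rpow_of_nonpos hkpos hkN (neg_nonpos.2 hτ.le)
    nlinarith
  set U : Set UnitAddCircle := ⋃ n ∈ (Finset.univ : Finset (Fin l → Fin N)), Metric.closedBall (θ n) r with hUdef
  have hvol : volume.real U = N ^ l * (2 * r) := by
    rw [hUdef, measureReal_biUnion_finset hdisj (fun _ _ => Metric.isClosed_closedBall.measurableSet)]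
    have : ∀ n, volume.real (Metric.closedBall (θ n) r) = 2 * r := by
      intro n
      rw [measureReal_def, AddCircle.volume_closedBall, min_eq_right hr2, ENNReal.toReal_ofReal (by positivity)]
    simp [this]
  rw [← hvol]
  apply bessel_aux
  · exact Finset.measurableSet_biUnion _ (fun _ _ => Metric.isClosed_closedBall.measurableSet)
  · intro q hq t ht
    simp only [hUdef, Set.mem_iUnion] at ht
    obtain ⟨n, -, ht⟩ := ht
    rw [Metric.mem_closedBall, dist_eq_norm] at ht
    obtain ⟨hq1, hq2⟩ := hS q hq
    have e : q • t = q • (t - θ n) + ∑ i, ((n i : ℕ)) • (((q:ℝ) * x i : ℝ) : UnitAddCircle) := by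
      have : q • θ n = ∑ i, ((n i : ℕ)) • (((q:ℝ) * x i : ℝ) : UnitAddCircle) := by
        simp only [θ, ← AddCircle.coe_nsmul]
        have hsum : ∀ f : Fin l → ℝ, ((∑ i, f i : ℝ) : UnitAddCircle) = ∑ i, (f i : UnitAddCircle) :=
          fun f => map_sum (QuotientAddGroup.mk' (AddSubgroup.zmultiples (1:ℝ))) f _
        rw [← hsum]
        congr 1
        simp only [nsmul_eq_mul, Finset.mul_sum]
        apply Finset.sum_congr rfl
        intro i _; ring
      rw [← this, smul_sub, sub_add_cancel]
    rw [e]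
    have b1 : ‖q • (t - θ n)‖ ≤ Q * r := by
      refine norm_nsmul_le.trans ?_
      exact mul_le_mul hq1 ht (norm_nonneg _) (le_trans (Nat.cast_nonneg q) hq1)
    have b2 : ‖∑ i, ((n i : ℕ)) • (((q:ℝ) * x i : ℝ) : UnitAddCircle)‖ ≤ l * (N * ε) := by
      refine (norm_sum_le _ _).trans ?_
      have : ∀ i ∈ (Finset.univ : Finset (Fin l)),
          ‖((n i : ℕ)) • (((q:ℝ) * x i : ℝ) : UnitAddCircle)‖ ≤ N * ε := by
        intro i _
        refine norm_nsmul_le.trans ?_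
        have h1 := norm_le_of_distInt hq2 i
        have h2 : ((n i : ℕ) : ℝ) ≤ N := by exact_mod_cast (n i).2.le
        gcongr
      refine (Finset.sum_le_card_nsmul _ _ _ this).trans ?_
      simp
    exact (norm_add_le _ _).trans (by linarith)
  · rw [hvol]; positivity

lemma type_aux {l : ℕ} (d : ℕ) (x : Fin l → ℝ) (htype : tauD x < (d : ℝ≥0∞)) :
    ∃ c τ : ℝ, 0 < c ∧ 0 < τ ∧ τ < d ∧ ∀ n : Fin l → ℤ, n ≠ 0 →
      c * ‖fun i => ((n i : ℝ))‖ ^ (-τ) ≤ distZ (∑ i, (n i : ℝ) * x i) := by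
  obtain ⟨τ, h1, h2⟩ := ENNReal.lt_iff_exists_nnreal_btwn.1 htype
  have hτ : 0 < (τ:ℝ) := by
    have : (0:ℝ≥0∞) < τ := lt_of_le_of_lt bot_le h1
    exact_mod_cast this
  have hτd : (τ:ℝ) < d := by exact_mod_cast h2
  set E : Set (Fin l → ℤ) := {n : Fin l → ℤ | n ≠ 0 ∧
      distZ (∑ i, (n i : ℝ) * x i) < ‖fun i => ((n i : ℝ))‖ ^ (-(τ:ℝ))} with hE
  have hfin : E.Finite := by
    by_contra hinf
    have : ENNReal.ofReal (τ:ℝ) ≤ tauD x := by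
      unfold tauD
      exact le_iSup₂_of_le (τ:ℝ) ⟨hτ, hinf⟩ le_rfl
    rw [ENNReal.ofReal_coe_nnreal] at this
    exact absurd h1 (not_lt.2 this)
  have npos : ∀ n : Fin l → ℤ, n ≠ 0 → 0 < ‖fun i => ((n i : ℝ))‖ := by
    intro n hn
    rw [norm_pos_iff]
    intro h0; apply hn; ext i
    simpa using congrFun h0 i
  have dpos : ∀ n : Fin l → ℤ, n ≠ 0 → 0 < distZ (∑ i, (n i : ℝ) * x i) := by
    intro n hn
    rw [distZ_eq, norm_pos_iff]
    intro h0
    apply Set.infinite_of_injective_forall_mem (f := fun k : ℕ => (k + 1) • n) (s := E) _ _ hfin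
    · intro a b hab
      have hi : ∃ i, n i ≠ 0 := by
        by_contra! hcon
        exact hn (funext hcon)
      obtain ⟨i, hi⟩ := hi
      have := congrFun hab i
      simp only [Pi.smul_apply, nsmul_eq_mul] at this
      have := mul_right_cancel₀ hi this
      push_cast at this
      omega
    · intro k
      have hk : (k+1) • n ≠ 0 := smul_ne_zero (by omega) hn
      refine ⟨hk, ?_⟩
      have : ∑ i, ((((k+1) • n) i : ℤ) : ℝ) * x i = (k+1) • ∑ i, (n i : ℝ) * x i := by
        simp only [Pi.smul_apply, nsmul_eq_mul, Finset.mul_sum]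
        apply Finset.sum_congr rfl
        intro i _; push_cast; ring
      rw [distZ_eq, this, AddCircle.coe_nsmul, h0]
      simp only [smul_zero, norm_zero]
      exact Real.rpow_pos_of_pos (npos _ hk) _
  have hc : ∃ c : ℝ, 0 < c ∧ ∀ n ∈ E, c * ‖fun i => ((n i : ℝ))‖ ^ (-(τ:ℝ)) ≤ distZ (∑ i, (n i : ℝ) * x i) := by
    rcases E.eq_empty_or_nonempty with h | h
    · exact ⟨1, one_pos, by simp [h]⟩
    · obtain ⟨m, hm, hmin⟩ := Set.exists_min_image E
        (fun n => distZ (∑ i, (n i : ℝ) * x i) / ‖fun i => ((n i : ℝ))‖ ^ (-(τ:ℝ))) hfin h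
      refine ⟨_, div_pos (dpos m hm.1) (Real.rpow_pos_of_pos (npos m hm.1) (-(τ:ℝ))), fun n hn => ?_⟩
      rw [← le_div_iff₀ (Real.rpow_pos_of_pos (npos n hn.1) _)]
      exact hmin n hn
  obtain ⟨c, hc, hcE⟩ := hc
  refine ⟨min c 1, τ, by positivity, hτ, hτd, fun n hn => ?_⟩
  have hp := Real.rpow_pos_of_pos (npos n hn) (-(τ:ℝ))
  by_cases hnE : n ∈ E
  · exact (mul_le_mul_of_nonneg_right (min_le_left _ _) hp.le).trans (hcE n hnE)
  · have : ‖fun i => ((n i : ℝ))‖ ^ (-(τ:ℝ)) ≤ distZ (∑ i, (n i : ℝ) * x i) := by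
      by_contra hcon
      exact hnE ⟨hn, not_le.1 hcon⟩
    calc _ ≤ 1 * ‖fun i => ((n i : ℝ))‖ ^ (-(τ:ℝ)) := mul_le_mul_of_nonneg_right (min_le_right _ _) hp.le
      _ ≤ _ := by linarith

lemma dyadic_aux (f : ℕ → ℝ) (hf : ∀ n, 0 ≤ f n) (C : ℝ)
    (h : ∀ᶠ j : ℕ in Filter.atTop, ∑ q ∈ Finset.Ico (2^j) (2^(j+1)), f q ≤ C / (j:ℝ)^2) :
    Summable f := by
  set b : ℕ → ℝ := fun j => ∑ q ∈ Finset.Ico (2^j) (2^(j+1)), f q with hb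
  have hb0 : ∀ j, 0 ≤ b j := fun j => Finset.sum_nonneg fun q _ => hf q
  have hbs : Summable b := by
    have hs : Summable fun j : ℕ => C / (j:ℝ)^2 := by
      simpa [div_eq_mul_inv] using (Real.summable_nat_pow_inv.2 (by norm_num : 1 < 2)).mul_left C
    apply Summable.of_norm_bounded_eventually_nat hs
    filter_upwards [h] with j hj
    rw [Real.norm_of_nonneg (hb0 j)]
    exact hj
  apply summable_of_sum_range_le (c := f 0 + ∑' j, b j) hf
  intro n
  have e : ∀ J : ℕ, ∑ q ∈ Finset.range (2^J), f q = f 0 + ∑ j ∈ Finset.range J, b j := by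
    intro J
    induction J with
    | zero => simp
    | succ J ih =>
      rw [Finset.sum_range_succ, ← add_assoc, ← ih, hb, Finset.range_eq_Ico, Finset.range_eq_Ico,
        Finset.sum_Ico_consecutive _ (by simp) (Nat.pow_le_pow_right (by norm_num) (by omega))]
  calc ∑ q ∈ Finset.range n, f q ≤ ∑ q ∈ Finset.range (2^n), f q := by
        apply Finset.sum_le_sum_of_subset_of_nonneg
        · apply Finset.range_mono; exact Nat.lt_two_pow_self.le
        · intros; exact hf _
    _ = _ := e n
    _ ≤ _ := by
        gcongr
        exact hbs.sum_le_tsum _ (fun j _ => hb0 j)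

theorem stmt_15 (l d : ℕ) (hd : d = l + 1) (hd2 : 2 ≤ d) (x : Fin l → ℝ)
    (htype : tauD x < (d : ℝ≥0∞))
    (φ : ℕ → ℝ) (hφ : ∀ q : ℕ, φ q = ((q : ℝ) * Real.log q ^ 2) ^ (-(1 / d : ℝ))) :
    Summable fun q : ℕ =>
      if 2 ≤ q ∧ distInt (fun i => (q : ℝ) * x i) < φ q then φ q else 0 := by
  obtain ⟨c, τ, hc, hτ, hτd, hx⟩ := type_aux d x htype
  have hφ0 : ∀ q, 0 ≤ φ q := fun q => by rw [hφ]; positivity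
  have hl : (1:ℝ) ≤ l := by exact_mod_cast (by omega : 1 ≤ l)
  have hd0 : (0:ℝ) < d := by positivity
  have hL := Real.log_pos (by norm_num : (1:ℝ) < 2)
  set L := Real.log 2 with hLdef
  set A : ℕ → ℝ := fun j => (2:ℝ)^j * (j * L)^2 with hA
  have hε : ∀ j, φ (2^j) = A j ^ (-(1/d:ℝ)) := by
    intro j; rw [hφ]; simp [hA, hLdef, Real.log_pow]
  have hjL : Filter.Tendsto (fun j : ℕ => (j:ℝ) * L) Filter.atTop Filter.atTop :=
    tendsto_natCast_atTop_atTop.atTop_mul_const hL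
  have hs1 : 0 < 1 - τ/d := by rw [sub_pos, div_lt_one hd0]; exact hτd
  have hT1 := ((tendsto_rpow_mul_exp_neg_mul_atTop_nhds_zero (2*(τ/d)) (1-τ/d) hs1).comp hjL).eventually
    (gt_mem_nhds (show (0:ℝ) < 12 * c by positivity))
  have hAt : Filter.Tendsto A Filter.atTop Filter.atTop := by
    apply Filter.Tendsto.atTop_mul_atTop₀
    · exact tendsto_pow_atTop_atTop_of_one_lt (by norm_num)
    · exact (Filter.tendsto_pow_atTop (by norm_num)).comp hjL
  have hT2 := (((tendsto_rpow_neg_atTop (show (0:ℝ) < 1/d by positivity)).comp hAt)).eventually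
    (gt_mem_nhds (show (0:ℝ) < 1/(12*l) by positivity))
  apply dyadic_aux _ _ (48 * (24*l)^l / L^2)
  · filter_upwards [hT1, hT2, Filter.eventually_ge_atTop 1] with j h1 h2 hj
    simp only [Function.comp] at h1 h2
    have hj0 : (0:ℝ) < j := by exact_mod_cast hj
    have hApos : 0 < A j := by simp only [hA]; positivity
    rw [← hε] at h2
    set ε := φ (2^j) with hεdef
    have hεpos : 0 < ε := by rw [hεdef, hε]; positivity
    rw [lt_div_iff₀ (by positivity)] at h2
    have hmono : ∀ q : ℕ, 2^j ≤ q → φ q ≤ ε := by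
      intro q hq
      rw [hεdef, hε, hφ]
      have hq' : (2:ℝ)^j ≤ q := by exact_mod_cast hq
      have hlog : j * L ≤ Real.log q := by
        rw [hLdef, ← Real.log_pow]
        exact Real.log_le_log (by positivity) hq'
      apply Real.rpow_le_rpow_of_nonpos hApos
      · simp only [hA]; gcongr
      · rw [neg_nonpos]; positivity
    set S := (Finset.Ico (2^j) (2^(j+1))).filter
      (fun q : ℕ => 2 ≤ q ∧ distInt (fun i => (q : ℝ) * x i) < φ q) with hSdef
    set M : ℝ := 1/(12*l*ε) with hM
    have hM1 : 1 ≤ M := by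
      rw [hM, le_div_iff₀ (by positivity)]; linarith
    set N := ⌊M⌋₊ with hN
    have hN1 : 1 ≤ N := Nat.one_le_floor_iff _ |>.2 hM1
    have hN1' : (1:ℝ) ≤ N := by exact_mod_cast hN1
    have hNM : (N:ℝ) ≤ M := Nat.floor_le (by linarith)
    have hNM2 : M / 2 ≤ N := by
      have := Nat.lt_floor_add_one M
      linarith
    have hME : l * (M * ε) = 1/12 := by
      rw [hM]; field_simp
    have hcount := count_aux x c τ hc hτ hx N hN1 ((2:ℝ)^(j+1)) ε (1/(24*2^j)) (by positivity)
      (by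
        have : (1:ℝ) ≤ 2^j := one_le_pow₀ (by norm_num)
        rw [mul_one_div, div_le_one (by positivity)]; linarith) hεpos.le
      (by
        have hNτ : (N:ℝ)^τ < 12 * c * 2^j := by
          have a1 : (N:ℝ) ≤ ε⁻¹ := by
            refine hNM.trans ?_
            rw [hM, one_div]
            apply inv_anti₀ hεpos
            nlinarith
          have a2 : (N:ℝ)^τ ≤ A j ^ (τ/d) := by
            refine (Real.rpow_le_rpow (by positivity) a1 hτ.le).trans (le_of_eq ?_)
            rw [hεdef, hε, ← Real.rpow_neg hApos.le, ← Real.rpow_mul hApos.le]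
            congr 1; ring
          have a3 : A j ^ (τ/d) = (2:ℝ)^j * ((j*L)^(2*(τ/d)) * Real.exp (-(1-τ/d)*(j*L))) := by
            have e2 : (2:ℝ)^j = Real.exp (j*L) := by
              rw [Real.exp_nat_mul, hLdef, Real.exp_log (by norm_num)]
            simp only [hA]
            rw [Real.mul_rpow (by positivity) (by positivity), e2, ← Real.exp_mul,
              ← Real.rpow_natCast (j*L) 2, ← Real.rpow_mul (by positivity),
              mul_left_comm, ← Real.exp_add, mul_comm]
            push_cast
            congr 2; ring
          rw [a3] at a2
          have : (0:ℝ) < 2^j := by positivity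
          nlinarith
        rw [Real.rpow_neg (by positivity), ← div_eq_mul_inv, lt_div_iff₀ (by positivity)]
        have : (0:ℝ) < 2^j := by positivity
        rw [mul_one_div, div_mul_eq_mul_div, div_lt_iff₀ (by positivity)]
        nlinarith)
      (by
        have : (2:ℝ)^(j+1) * (1/(24*2^j)) = 1/12 := by
          rw [pow_succ]; field_simp; norm_num
        rw [this]
        have : l * (N * ε) ≤ l * (M * ε) := by gcongr
        linarith) S
      (by
        intro q hq
        simp only [hSdef, Finset.mem_filter, Finset.mem_Ico] at hq
        refine ⟨by exact_mod_cast hq.1.2.le, hq.2.2.trans_le (hmono q hq.1.1)⟩)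
    have hsum : (∑ q ∈ (Finset.Ico (2^j) (2^(j+1)) : Finset ℕ),
        if 2 ≤ q ∧ distInt (fun i => (q : ℝ) * x i) < φ q then φ q else 0) ≤ S.card * ε := by
      rw [← Finset.sum_filter]
      refine (Finset.sum_le_card_nsmul _ _ ε ?_).trans (by rw [nsmul_eq_mul])
      intro q hq
      simp only [Finset.mem_filter, Finset.mem_Ico] at hq
      exact hmono q hq.1.1
    refine hsum.trans ?_
    have hεd : ε ^ (l+1) = (A j)⁻¹ := by
      rw [← hd, hεdef, hε, ← Real.rpow_natCast, ← Real.rpow_mul hApos.le, ← Real.rpow_neg_one]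
      congr 1; field_simp
    have hMl : (M/2)^l ≤ (N:ℝ)^l := by gcongr
    have hM2 : (M/2)^l * (24*l*ε)^l = 1 := by
      rw [← mul_pow]
      have : M / 2 * (24*l*ε) = 1 := by linarith
      rw [this, one_pow]
    have h2j : (0:ℝ) < 2^j := by positivity
    have hc2 : (S.card:ℝ) * (M/2)^l ≤ 48 * 2^j := by
      have : (S.card:ℝ) * N^l ≤ 48 * 2^j := by
        have e : (S.card : ℝ) * (N ^ l * (2 * (1/(24*2^j)))) = S.card * N^l / (12*2^j) := by
          field_simp; ring
        rw [e, div_le_iff₀ (by positivity)] at hcount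
        linarith
      refine le_trans ?_ this
      gcongr
    calc (S.card:ℝ) * ε = (S.card * (M/2)^l) * ((24*l*ε)^l * ε) := by
          rw [mul_assoc, ← mul_assoc ((M/2)^l), hM2, one_mul]
      _ ≤ (48 * 2^j) * ((24*l*ε)^l * ε) := by gcongr
      _ = 48 * (24*l)^l * 2^j * ε^(l+1) := by rw [mul_pow]; ring
      _ = 48 * (24*l)^l / L^2 / j^2 := by
          rw [hεd]; simp only [hA]; field_simp
  · intro q
    split_ifs
    · exact hφ0 q
    · exact le_rfl
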